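/- arXiv:2509.18992 — 3 statements merged into one kernel-verified Lean document; each statement's English description precedes it below -/
import Mathlib

section
/- Let N ≥ 3, γ > 0, t₀ ∈ ℝ, A ∈ ℝ³, and f_0,…,f_{N-1} ∈ ℝ³ (indices mod N) satisfy, for every k: |f_k − f_{k-1}|² = 1, A·f_k = 0, |f_k|² = |f_{k-1}|², and 4|A|² = |f_k + f_{k-1}|². For t > −t₀ define P_k(t) := (2(t+t₀))^{−1/2} (iA + f_k)/γ ∈ ℂ³ and ΔP_{k-1}(t) := P_k(t) − P_{k-1}(t). Then for every k and every t > −t₀, d/dt [ (P_k(t) + P_{k-1}(t))/2 ] = γ² [ ( ((P_k(t)+P_{k-1}(t))/2) · ΔP_{k-1}(t) ) ΔP_{k-1}(t) − |ΔP_{k-1}(t)|² (P_k(t)+P_{k-1}(t))/2 ]. In other words, the discretized Euler ensemble solves Migdal's discretized liquid loop momentum equation. -/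
noncomputable section

open scoped RealInnerProductSpace BigOperators
open MeasureTheory

/-- ℝ³ as a Euclidean space. -/
abbrev E3 : Type := EuclideanSpace ℝ (Fin 3)

/-- The vector of `E3` with the three given coordinates. -/
def vec3 (a b c : ℝ) : E3 := (WithLp.equiv 2 (Fin 3 → ℝ)).symm ![a, b, c]

/-- Cross product on `E3`. -/
def cross3 (v w : E3) : E3 :=
  vec3 (v 1 * w 2 - v 2 * w 1) (v 2 * w 0 - v 0 * w 2) (v 0 * w 1 - v 1 * w 0)

/-- `j`-th standard basis vector of `E3`. -/
def e3 (j : Fin 3) : E3 := EuclideanSpace.single j 1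

/-- Curl (vorticity) of a vector field on `E3`. -/
def curl3 (u : E3 → E3) (x : E3) : E3 :=
  vec3 (fderiv ℝ u x (e3 1) 2 - fderiv ℝ u x (e3 2) 1)
       (fderiv ℝ u x (e3 2) 0 - fderiv ℝ u x (e3 0) 2)
       (fderiv ℝ u x (e3 0) 1 - fderiv ℝ u x (e3 1) 0)

/-- Divergence of a vector field on `E3`. -/
def div3 (u : E3 → E3) (x : E3) : ℝ := ∑ j : Fin 3, fderiv ℝ u x (e3 j) j

/-- Componentwise Laplacian of a vector field on `E3`. -/
def lap3 (u : E3 → E3) (x : E3) : E3 :=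
  ∑ j : Fin 3, fderiv ℝ (fun y => fderiv ℝ u y (e3 j)) x (e3 j)

/-- Transposed Jacobian of `ω` at `x`, applied to `v`:  `((Dω)ᵀ v)_j = ∑_i ∂_j ω_i v_i`. -/
def jacT (ω : E3 → E3) (x v : E3) : E3 :=
  (WithLp.equiv 2 (Fin 3 → ℝ)).symm fun j => ⟪fderiv ℝ ω x (e3 j), v⟫

/-- Sup norm of the `j`-th derivative of a vector field. -/
def supDeriv (j : ℕ) (u : E3 → E3) : ℝ := ⨆ x : E3, ‖iteratedFDeriv ℝ j u x‖

/-- `C^m` norm: maximum of the sup norms of the derivatives of order `≤ m`. -/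
def cNorm (m : ℕ) (u : E3 → E3) : ℝ :=
  (Finset.range (m + 1)).sup' (Finset.nonempty_range_iff.mpr (Nat.succ_ne_zero m))
    fun j => supDeriv j u

/-- Sobolev `H^K` norm. -/
def sobNorm (K : ℕ) (u : E3 → E3) : ℝ :=
  Real.sqrt (∑ j ∈ Finset.range (K + 1), ∫ x : E3, ‖iteratedFDeriv ℝ j u x‖ ^ 2)

/-- Circulation of `u` along the closed polygon with vertices `C 0, …, C (N-1)`. -/
def circulation (N : ℕ) [NeZero N] (u : E3 → E3) (C : Fin N → E3) : ℝ :=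
  ∑ k : Fin N, ∫ a in (0:ℝ)..(1:ℝ), ⟪u ((1 - a) • C k + a • C (k + 1)), C (k + 1) - C k⟫

/-- `⟨ω⟩` : average of `ω` along the segment joining `(xm+xp)/2` to `y`. -/
def segAvg (ω : E3 → E3) (xm y xp : E3) : E3 :=
  ∫ a in (0:ℝ)..(1:ℝ), ω (a • y + (1 - a) • ((2:ℝ)⁻¹ • (xm + xp)))

variable {N : ℕ}

/-- Partial derivative of a real functional of the vertices with respect to
the `j`-th coordinate of the vertex `k`. -/
def vpdR (k : Fin N) (j : Fin 3) (F : (Fin N → E3) → ℝ) (C : Fin N → E3) : ℝ :=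
  fderiv ℝ (fun x => F (Function.update C k x)) (C k) (e3 j)

/-- Gradient of a real functional of the vertices with respect to the vertex `k`. -/
def vgradR (k : Fin N) (F : (Fin N → E3) → ℝ) (C : Fin N → E3) : E3 :=
  gradient (fun x => F (Function.update C k x)) (C k)

/-- `∇_{C_a} × ∇_{C_b}` applied to a real functional of the vertices. -/
def gradCross (a b : Fin N) (F : (Fin N → E3) → ℝ) (C : Fin N → E3) : E3 :=
  vec3 (vpdR a 1 (vpdR b 2 F) C - vpdR a 2 (vpdR b 1 F) C)
       (vpdR a 2 (vpdR b 0 F) C - vpdR a 0 (vpdR b 2 F) C)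
       (vpdR a 0 (vpdR b 1 F) C - vpdR a 1 (vpdR b 0 F) C)

/-- Migdal's area derivative `(∑_{j>k} ∇_{C_j} + ½ ∇_{C_k}) × ∇_{C_k}` on real functionals. -/
def gradCrossM (k : Fin N) (F : (Fin N → E3) → ℝ) (C : Fin N → E3) : E3 :=
  (∑ j ∈ Finset.univ.filter (fun j : Fin N => (k : ℕ) < (j : ℕ)), gradCross j k F C)
    + (2:ℝ)⁻¹ • gradCross k k F C

/-- Partial derivative of a complex functional of the vertices. -/
def vpd (k : Fin N) (j : Fin 3) (F : (Fin N → E3) → ℂ) (C : Fin N → E3) : ℂ :=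
  fderiv ℝ (fun x => F (Function.update C k x)) (C k) (e3 j)

/-- `∇_{C_a} × ∇_{C_b}` on complex functionals. -/
def opCross (a b : Fin N) (F : (Fin N → E3) → ℂ) (C : Fin N → E3) : Fin 3 → ℂ :=
  ![vpd a 1 (vpd b 2 F) C - vpd a 2 (vpd b 1 F) C,
    vpd a 2 (vpd b 0 F) C - vpd a 0 (vpd b 2 F) C,
    vpd a 0 (vpd b 1 F) C - vpd a 1 (vpd b 0 F) C]

/-- `∇_{C_k} ×` applied to a `ℂ³`-valued functional of the vertices. -/
def vcurl (k : Fin N) (G : (Fin N → E3) → Fin 3 → ℂ) (C : Fin N → E3) : Fin 3 → ℂ :=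
  ![vpd k 1 (fun D => G D 2) C - vpd k 2 (fun D => G D 1) C,
    vpd k 2 (fun D => G D 0) C - vpd k 0 (fun D => G D 2) C,
    vpd k 0 (fun D => G D 1) C - vpd k 1 (fun D => G D 0) C]

/-- Embedding of a real vector into `ℂ³`. -/
def toC3 (v : E3) : Fin 3 → ℂ := fun j => (v j : ℂ)

/-- Bilinear (non-hermitian) dot product on `ℂ³`. -/
def cdot (v w : Fin 3 → ℂ) : ℂ := ∑ j : Fin 3, v j * w j

/-- Bilinear cross product on `ℂ³`. -/
def ccross3 (v w : Fin 3 → ℂ) : Fin 3 → ℂ :=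
  ![v 1 * w 2 - v 2 * w 1, v 2 * w 0 - v 0 * w 2, v 0 * w 1 - v 1 * w 0]

/-- Euclidean magnitude of a vector of `ℂ³`. -/
def cnorm3 (v : Fin 3 → ℂ) : ℝ := Real.sqrt (∑ j : Fin 3, Complex.normSq (v j))

/-- Pairing of a real vector with a complex vector. -/
def dotRC (v : E3) (w : Fin 3 → ℂ) : ℂ := ∑ j : Fin 3, (v j : ℂ) * w j

/-- A smooth cut-off `χ` which is `1` on `B_1(0)` and vanishes outside `B_2(0)`. -/
def IsCutoff (χ : E3 → ℝ) : Prop :=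
  ContDiff ℝ ((⊤ : ℕ∞) : WithTop ℕ∞) χ ∧ (∀ x : E3, ‖x‖ ≤ 1 → χ x = 1) ∧ (∀ x : E3, 2 ≤ ‖x‖ → χ x = 0)

/-- Kernel of the regularized Biot–Savart operator: `∇_y (χ(ℓ(x−y))/|x−y|)`. -/
def BSker (χ : E3 → ℝ) (ℓ : ℝ) (x y : E3) : E3 :=
  gradient (fun z => χ (ℓ • (x - z)) / ‖x - z‖) y

/-- Regularized Biot–Savart operator `BS_ℓ`. -/
def BSreg (χ : E3 → ℝ) (ℓ : ℝ) (ω : E3 → E3) (x : E3) : E3 :=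
  (4 * Real.pi)⁻¹ • ∫ y : E3, cross3 (ω y) (BSker χ ℓ x y)

/-- Regularized Biot–Savart operator on `ℂ³`-valued fields (componentwise). -/
def BSregC (χ : E3 → ℝ) (ℓ : ℝ) (ω : E3 → Fin 3 → ℂ) (x : E3) : Fin 3 → ℂ :=
  (4 * Real.pi)⁻¹ • ∫ y : E3, ccross3 (ω y) (toC3 (BSker χ ℓ x y))

/-- The discretized vorticity operator `Ω_k = (iν/γ) ∇_{C_{k+1}} × ∇_{C_k}`. -/
def vortOp [NeZero N] (γ ν : ℝ) (k : Fin N) (F : (Fin N → E3) → ℂ) (C : Fin N → E3) :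
    Fin 3 → ℂ :=
  (Complex.I * ν / γ) • opCross (k + 1) k F C

/-- The discretized diffusion operator `𝒟_k = 2 ∇_{C_k} × Ω_k`. -/
def diffOp [NeZero N] (γ ν : ℝ) (k : Fin N) (F : (Fin N → E3) → ℂ) (C : Fin N → E3) :
    Fin 3 → ℂ :=
  (2:ℂ) • vcurl k (vortOp γ ν k F) C

/-- The discretized velocity operator `U_k = (1/log(1/ρ)) BS_ℓ ∘ Ω_k`,
with `BS_ℓ` acting in the variable `C_k`. -/
def velOp [NeZero N] (χ : E3 → ℝ) (ℓ ρ γ ν : ℝ) (k : Fin N) (F : (Fin N → E3) → ℂ)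
    (C : Fin N → E3) : Fin 3 → ℂ :=
  (Real.log (1 / ρ))⁻¹ • BSregC χ ℓ (fun x => vortOp γ ν k F (Function.update C k x)) (C k)

/-- Levi-Civita symbol on `Fin 3`. -/
def levi3 (a b c : Fin 3) : ℝ :=
  if (a, b, c) = (0, 1, 2) ∨ (a, b, c) = (1, 2, 0) ∨ (a, b, c) = (2, 0, 1) then 1
  else if (a, b, c) = (2, 1, 0) ∨ (a, b, c) = (1, 0, 2) ∨ (a, b, c) = (0, 2, 1) then -1
  else 0

/-- The discretized advection operator `(Ω_{k+3} × U_k)_α = ε_{αij} Ω^i_{k+3} ∘ U^j_k`. -/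
def advecOp [NeZero N] (χ : E3 → ℝ) (ℓ ρ γ ν : ℝ) (k : Fin N) (F : (Fin N → E3) → ℂ)
    (C : Fin N → E3) : Fin 3 → ℂ :=
  fun α => ∑ i : Fin 3, ∑ j : Fin 3,
    (levi3 α i j : ℂ) * vortOp γ ν (k + 3) (fun D => velOp χ ℓ ρ γ ν k F D j) C i

/-- Migdal's discretized vorticity operator
`Ω^M_k = (iν/γ)(∑_{j=k+1}^{N-1} ∇_{C_j} + ½∇_{C_k}) × ∇_{C_k}`. -/
def vortOpM [NeZero N] (γ ν : ℝ) (k : Fin N) (F : (Fin N → E3) → ℂ) (C : Fin N → E3) :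
    Fin 3 → ℂ :=
  (Complex.I * ν / γ) •
    ((∑ j ∈ Finset.univ.filter (fun j : Fin N => (k : ℕ) < (j : ℕ)), opCross j k F C)
      + (2:ℂ)⁻¹ • opCross k k F C)

/-- Migdal's discretized diffusion operator `𝒟^M_k = 2 ∇_{C_k} × Ω^M_k`. -/
def diffOpM [NeZero N] (γ ν : ℝ) (k : Fin N) (F : (Fin N → E3) → ℂ) (C : Fin N → E3) :
    Fin 3 → ℂ :=
  (2:ℂ) • vcurl k (vortOpM γ ν k F) C

/-- Migdal's discretized velocity operator `U^M_k = (1/log(1/ρ)) BS_ℓ ∘ Ω^M_k`. -/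
def velOpM [NeZero N] (χ : E3 → ℝ) (ℓ ρ γ ν : ℝ) (k : Fin N) (F : (Fin N → E3) → ℂ)
    (C : Fin N → E3) : Fin 3 → ℂ :=
  (Real.log (1 / ρ))⁻¹ • BSregC χ ℓ (fun x => vortOpM γ ν k F (Function.update C k x)) (C k)

/-- The loop functional `Ψ[u,C] = exp((iγ/ν) Γ[u,C])` as a function of the vertices. -/
def loopExp (γ ν : ℝ) (N : ℕ) [NeZero N] (u : E3 → E3) (C : Fin N → E3) : ℂ :=
  Complex.exp (Complex.I * γ / ν * (circulation N u C : ℂ))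

/-- The momentum loop functional `Ψ[P,C](t) = exp((iγ/ν) ∑_k P_k(t)·ΔC_k)`. -/
def momFun (γ ν : ℝ) (N : ℕ) [NeZero N] (P : Fin N → ℝ → Fin 3 → ℂ) (t : ℝ)
    (C : Fin N → E3) : ℂ :=
  Complex.exp (Complex.I * γ / ν * ∑ k : Fin N, cdot (P k t) (toC3 (C (k + 1) - C k)))

/-- The expression `E_k` of the discretized momentum loop equation, as a function of
`ΔP_{k-1}, ΔP_k, ΔP_{k+2}, ΔP_{k+3}` (and of `log N`). -/
def EkDef (γ ν NR : ℝ) (dPm dP dP2 dP3 : Fin 3 → ℂ) : Fin 3 → ℂ :=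
  ((Real.log NR)⁻¹ : ℂ) •
      ((Complex.I * γ / ν) •
        ccross3 (ccross3 dP3 dP2) (dP - (cdot dPm dP / cdot dPm dPm) • dPm))
    + ((2 * γ ^ 2 / ν : ℝ) : ℂ) • (cdot dPm dPm • dP - cdot dPm dP • dPm)

theorem hasDerivAt_inv_sqrt_div {γ t₀ t : ℝ} (hγ : γ ≠ 0) (ht : -t₀ < t) :
    HasDerivAt (fun s => (Real.sqrt (2 * (s + t₀)))⁻¹ / γ)
      (-γ ^ 2 * ((Real.sqrt (2 * (t + t₀)))⁻¹ / γ) ^ 3) t := by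
  have hpos : 0 < 2 * (t + t₀) := by linarith
  have hsqrt : Real.sqrt (2 * (t + t₀)) ≠ 0 := (Real.sqrt_pos.mpr hpos).ne'
  have hlin : HasDerivAt (fun s => 2 * (s + t₀)) 2 t := by
    simpa using ((hasDerivAt_id t).add_const t₀).const_mul 2
  refine (((hlin.sqrt hpos.ne').inv hsqrt).div_const γ).congr_deriv ?_
  field_simp

theorem sum_coe_mul_sub_coe (v w u : E3) :
    ∑ j : Fin 3, (v j : ℂ) * ((w j : ℂ) - (u j : ℂ)) = ((⟪v, w - u⟫ : ℝ) : ℂ) := by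
  simp [PiLp.inner_apply, Fin.sum_univ_three, mul_comm]

/-! ## Statement 16 -/
theorem stmt_16 (N : ℕ) [NeZero N] (hN : 3 ≤ N) (γ : ℝ) (hγ : 0 < γ) (t₀ : ℝ)
    (A : E3) (f : Fin N → E3)
    (h1 : ∀ k : Fin N, ‖f k - f (k - 1)‖ ^ 2 = 1)
    (h2 : ∀ k : Fin N, ⟪A, f k⟫ = 0)
    (h3 : ∀ k : Fin N, ‖f k‖ ^ 2 = ‖f (k - 1)‖ ^ 2)
    (h4 : ∀ k : Fin N, 4 * ‖A‖ ^ 2 = ‖f k + f (k - 1)‖ ^ 2)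
    (P : Fin N → ℝ → Fin 3 → ℂ)
    (hP : ∀ (κ : Fin N) (s : ℝ), -t₀ < s → ∀ j : Fin 3,
      P κ s j = (((Real.sqrt (2 * (s + t₀)))⁻¹ / γ : ℝ) : ℂ)
          * (Complex.I * (A j : ℂ) + ((f κ j : ℝ) : ℂ))) :
    ∀ k : Fin N, ∀ t : ℝ, -t₀ < t →
      (fun j => deriv (fun s => (P k s j + P (k - 1) s j) / 2) t)
        = ((γ : ℂ) ^ 2) •
            ((cdot (fun j => (P k t j + P (k - 1) t j) / 2)
                  (fun j => P k t j - P (k - 1) t j))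
                • (fun j => P k t j - P (k - 1) t j)
              - (cdot (fun j => P k t j - P (k - 1) t j)
                  (fun j => P k t j - P (k - 1) t j))
                • fun j => (P k t j + P (k - 1) t j) / 2) := by
  intro k t ht
  have hdot (v : E3) : ∑ j : Fin 3, (v j : ℂ) * ((f k j : ℂ) - (f (k - 1) j : ℂ))
      = ((⟪v, f k - f (k - 1)⟫ : ℝ) : ℂ) := sum_coe_mul_sub_coe v (f k) (f (k - 1))
  have hA : ⟪A, f k - f (k - 1)⟫ = 0 := by rw [inner_sub_right, h2, h2, sub_zero]
  have hF : ⟪f k + f (k - 1), f k - f (k - 1)⟫ = 0 :=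
    (real_inner_add_sub_eq_zero_iff _ _).mpr
      ((sq_eq_sq₀ (norm_nonneg _) (norm_nonneg _)).mp (h3 k))
  have hD : ⟪f k - f (k - 1), f k - f (k - 1)⟫ = 1 := by
    rw [real_inner_self_eq_norm_sq, h1]
  have eA := hdot A
  have eF := hdot (f k + f (k - 1))
  have eD := hdot (f k - f (k - 1))
  rw [hA] at eA
  rw [hF] at eF
  rw [hD] at eD
  simp only [Fin.sum_univ_three, PiLp.add_apply, PiLp.sub_apply, Complex.ofReal_add,
    Complex.ofReal_sub, Complex.ofReal_zero, Complex.ofReal_one] at eA eF eD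
  funext j
  have hderiv : HasDerivAt (fun s => (P k s j + P (k - 1) s j) / 2)
      (((-γ ^ 2 * ((Real.sqrt (2 * (t + t₀)))⁻¹ / γ) ^ 3 : ℝ) : ℂ) *
        (Complex.I * (A j : ℂ) + ((f k j : ℂ) + (f (k - 1) j : ℂ)) / 2)) t := by
    refine ((hasDerivAt_inv_sqrt_div hγ.ne' ht).ofReal_comp.mul_const _).congr_of_eventuallyEq ?_
    filter_upwards [lt_mem_nhds ht] with s hs
    rw [hP k s hs j, hP (k - 1) s hs j]
    ring
  rw [hderiv.deriv]
  simp only [Pi.smul_apply, Pi.sub_apply, smul_eq_mul, cdot, Fin.sum_univ_three, hP k t ht,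
    hP (k - 1) t ht]
  generalize (Real.sqrt (2 * (t + t₀)))⁻¹ / γ = q
  push_cast
  linear_combination
    -(γ : ℂ) ^ 2 * (q : ℂ) ^ 3 * ((f k j : ℂ) - (f (k - 1) j : ℂ)) * (Complex.I * eA + eF / 2)
      + (γ : ℂ) ^ 2 * (q : ℂ) ^ 3
        * (Complex.I * (A j : ℂ) + ((f k j : ℂ) + (f (k - 1) j : ℂ)) / 2) * eD

end
end

section
/- Let ℓ ∈ (0,1], M ≥ 1, m ≥ 0, and let ω : ℝ³ → ℝ³ be a measurable (e.g. continuous) vector field satisfying |ω(x)| ≤ M (1 + |x|^m) for every x ∈ ℝ³. Then |BS_ℓ[ω](x)| ≤ C(m) ℓ^{−m−1} M (1 + |x|^m) for every x ∈ ℝ³, where C(m) depends only on m and on the cut-off χ. -/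
noncomputable section

open scoped RealInnerProductSpace BigOperators
open MeasureTheory

variable {N : ℕ}

/-- The singular kernel `|z|⁻²` truncated to the ball of radius `3`. -/
def truncInvSq (z : E3) : ℝ := (Metric.ball (0 : E3) 3).indicator (fun z => ‖z‖ ^ (-2 : ℝ)) z

lemma truncInvSq_nonneg (z : E3) : 0 ≤ truncInvSq z :=
  Set.indicator_nonneg (fun _ _ => by positivity) z

lemma integrable_truncInvSq : Integrable truncInvSq := by
  refine (integrable_indicator_iff Metric.isOpen_ball.measurableSet).2 ?_
  refine integrableOn_ball_of_norm_le_rpow (C := 1) (α := 2) (by simp) (by simp; norm_num)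
    (Filter.Eventually.of_forall fun z => ?_) (by measurability)
  rw [one_mul, Real.norm_of_nonneg (by positivity)]

lemma integrable_truncInvSq_smul_sub {ℓ : ℝ} (hℓ : 0 < ℓ) (x : E3) :
    Integrable fun y => truncInvSq (ℓ • (x - y)) :=
  ((integrable_comp_smul_iff volume truncInvSq hℓ.ne').2 integrable_truncInvSq).comp_sub_left x

lemma integral_truncInvSq_smul_sub {ℓ : ℝ} (hℓ : 0 < ℓ) (x : E3) :
    ∫ y, truncInvSq (ℓ • (x - y)) = (ℓ ^ 3)⁻¹ * ∫ z, truncInvSq z := by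
  rw [integral_sub_left_eq_self (fun z => truncInvSq (ℓ • z)) volume x,
    Measure.integral_comp_smul, finrank_euclideanSpace_fin, abs_of_pos (by positivity),
    smul_eq_mul]

lemma norm_cross3_le (v w : E3) : ‖cross3 v w‖ ≤ ‖v‖ * ‖w‖ := by
  refine le_of_sq_le_sq ?_ (by positivity)
  rw [mul_pow, EuclideanSpace.norm_sq_eq, EuclideanSpace.norm_sq_eq, EuclideanSpace.norm_sq_eq]
  simp only [cross3, vec3, Fin.sum_univ_three, Real.norm_eq_abs, sq_abs]
  simp
  nlinarith [sq_nonneg (v 0 * w 0 + v 1 * w 1 + v 2 * w 2)]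

namespace IsCutoff

variable {χ : E3 → ℝ}

lemma hasCompactSupport (hχ : IsCutoff χ) : HasCompactSupport χ := by
  refine HasCompactSupport.intro (isCompact_closedBall (0 : E3) 2) fun z hz => hχ.2.2 z ?_
  simp only [Metric.mem_closedBall, dist_zero_right, not_le] at hz
  exact hz.le

lemma differentiable (hχ : IsCutoff χ) : Differentiable ℝ χ :=
  hχ.1.differentiable (by simp)

lemma exists_norm_le (hχ : IsCutoff χ) : ∃ A, ∀ z, ‖χ z‖ ≤ A :=
  hχ.hasCompactSupport.exists_bound_of_continuous hχ.1.continuous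

lemma exists_norm_fderiv_le (hχ : IsCutoff χ) : ∃ B, ∀ z, ‖fderiv ℝ χ z‖ ≤ B :=
  (hχ.hasCompactSupport.fderiv ℝ).exists_bound_of_continuous
    (hχ.1.continuous_fderiv (by simp))

lemma BSker_eq_zero (hχ : IsCutoff χ) {ℓ : ℝ} {x y : E3} (h : 2 < ‖ℓ • (x - y)‖) :
    BSker χ ℓ x y = 0 := by
  have hev : (fun z => χ (ℓ • (x - z)) / ‖x - z‖) =ᶠ[nhds y] fun _ => (0 : ℝ) := by
    have hc : Continuous fun z : E3 => ‖ℓ • (x - z)‖ := by fun_prop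
    filter_upwards [hc.continuousAt.eventually (lt_mem_nhds h)] with z hz
    rw [hχ.2.2 _ hz.le, zero_div]
  rw [BSker, hev.gradient_eq, gradient_fun_const]

end IsCutoff

lemma norm_BSker_le {χ : E3 → ℝ} (hd : Differentiable ℝ χ) {A B : ℝ} (hA : ∀ z, ‖χ z‖ ≤ A)
    (hB : ∀ z, ‖fderiv ℝ χ z‖ ≤ B) {ℓ : ℝ} (hℓ : 0 < ℓ) {x y : E3} (hxy : x ≠ y) :
    ‖BSker χ ℓ x y‖ ≤ A / ‖x - y‖ ^ 2 + B * ℓ / ‖x - y‖ := by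
  have hne : x - y ≠ 0 := sub_ne_zero.2 hxy
  have hn : 0 < ‖x - y‖ := norm_pos_iff.2 hne
  have hsub : HasFDerivAt (fun z : E3 => x - z) (-ContinuousLinearMap.id ℝ E3) y :=
    (hasFDerivAt_id y).const_sub x
  have hχ : HasFDerivAt (fun z => χ (ℓ • (x - z)))
      ((fderiv ℝ χ (ℓ • (x - y))).comp (ℓ • -ContinuousLinearMap.id ℝ E3)) y :=
    (hd _).hasFDerivAt.comp y (hsub.const_smul ℓ)
  have hnorm : DifferentiableAt ℝ (fun z : E3 => ‖x - z‖) y :=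
    hsub.differentiableAt.norm ℝ hne
  have hlip : ‖fderiv ℝ (fun z : E3 => ‖x - z‖) y‖ ≤ 1 := by
    refine norm_fderiv_le_of_lipschitz (C := 1) ℝ (LipschitzWith.of_dist_le_mul fun a b => ?_)
    rw [Real.dist_eq, NNReal.coe_one, one_mul, dist_comm, dist_eq_norm]
    refine (abs_norm_sub_norm_le _ _).trans_eq (by congr 1; abel)
  have hinv := (hasDerivAt_inv hn.ne').comp_hasFDerivAt y hnorm.hasFDerivAt
  have hF := hχ.mul hinv
  have hgrad : ‖BSker χ ℓ x y‖ = ‖fderiv ℝ (fun z => χ (ℓ • (x - z)) / ‖x - z‖) y‖ := by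
    rw [BSker, gradient, LinearIsometryEquiv.norm_map]
  have hF' : fderiv ℝ (fun z => χ (ℓ • (x - z)) / ‖x - z‖) y = _ := hF.fderiv
  rw [hgrad, hF']
  refine (norm_add_le _ _).trans (add_le_add ?_ ?_)
  · rw [norm_smul, norm_smul, div_eq_mul_inv]
    have : ‖-(‖x - y‖ ^ 2)⁻¹‖ = (‖x - y‖ ^ 2)⁻¹ := by
      rw [norm_neg, Real.norm_of_nonneg (by positivity)]
    rw [this]
    have hA0 : 0 ≤ A := (norm_nonneg _).trans (hA 0)
    refine mul_le_mul (hA _) ?_ (by positivity) hA0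
    exact mul_le_of_le_one_right (by positivity) hlip
  · have hB0 : 0 ≤ B := (norm_nonneg _).trans (hB 0)
    rw [norm_smul, Function.comp_apply, norm_inv, norm_norm, mul_comm, ← div_eq_mul_inv]
    gcongr
    refine (ContinuousLinearMap.opNorm_comp_le _ _).trans ?_
    refine mul_le_mul (hB _) ?_ (norm_nonneg _) hB0
    rw [norm_smul, norm_neg, Real.norm_of_nonneg hℓ.le]
    exact mul_le_of_le_one_right hℓ.le ContinuousLinearMap.norm_id_le

lemma IsCutoff.exists_norm_BSker_le {χ : E3 → ℝ} (hχ : IsCutoff χ) :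
    ∃ K, 0 ≤ K ∧ ∀ ℓ : ℝ, 0 < ℓ → ∀ x y : E3, x ≠ y →
      ‖BSker χ ℓ x y‖ ≤ K * ℓ ^ 2 * truncInvSq (ℓ • (x - y)) := by
  obtain ⟨A, hA⟩ := hχ.exists_norm_le
  obtain ⟨B, hB⟩ := hχ.exists_norm_fderiv_le
  have hA0 : 0 ≤ A := (norm_nonneg _).trans (hA 0)
  have hB0 : 0 ≤ B := (norm_nonneg _).trans (hB 0)
  refine ⟨A + 3 * B, by positivity, fun ℓ hℓ x y hxy => ?_⟩
  have hn : 0 < ‖x - y‖ := norm_pos_iff.2 (sub_ne_zero.2 hxy)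
  have hnl : ‖ℓ • (x - y)‖ = ℓ * ‖x - y‖ := by rw [norm_smul, Real.norm_of_nonneg hℓ.le]
  rcases lt_or_ge ‖ℓ • (x - y)‖ 3 with h | h
  · refine (norm_BSker_le hχ.differentiable hA hB hℓ hxy).trans ?_
    rw [truncInvSq, Set.indicator_of_mem (by simpa using h), hnl, Real.rpow_neg (by positivity),
      Real.rpow_two]
    rw [hnl] at h
    have hR : (A + 3 * B) * ℓ ^ 2 * ((ℓ * ‖x - y‖) ^ 2)⁻¹
        = A / ‖x - y‖ ^ 2 + B * 3 / ‖x - y‖ ^ 2 := by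
      field_simp
    have hL : B * ℓ / ‖x - y‖ = B * (ℓ * ‖x - y‖) / ‖x - y‖ ^ 2 := by
      field_simp
    rw [hR, hL]
    gcongr
  · rw [hχ.BSker_eq_zero (by linarith), norm_zero]
    have := truncInvSq_nonneg (ℓ • (x - y))
    positivity

lemma one_add_norm_rpow_le {m : ℝ} (hm : 0 ≤ m) {ℓ : ℝ} (hℓ : 0 < ℓ) (hℓ1 : ℓ ≤ 1) {x y : E3}
    (h : ‖ℓ • (x - y)‖ ≤ 3) :
    1 + ‖y‖ ^ m ≤ (1 + 4 ^ m) * ℓ ^ (-m) * (1 + ‖x‖ ^ m) := by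
  have hmax : (1 : ℝ) ≤ max 1 ‖x‖ := le_max_left _ _
  have hy : ‖y‖ ≤ 4 * ℓ⁻¹ * max 1 ‖x‖ := by
    rw [norm_smul, Real.norm_of_nonneg hℓ.le] at h
    have h1 : ‖y‖ ≤ ‖x‖ + ‖x - y‖ := norm_le_norm_add_norm_sub _ _
    have h2 : ‖x - y‖ ≤ 3 * ℓ⁻¹ := by
      rw [← div_eq_mul_inv, le_div_iff₀ hℓ]; linarith
    have h3 : 1 ≤ ℓ⁻¹ := (one_le_inv₀ hℓ).2 hℓ1
    have h4 : ‖x‖ ≤ max 1 ‖x‖ := le_max_right _ _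
    nlinarith
  have hmaxm : (max 1 ‖x‖) ^ m ≤ 1 + ‖x‖ ^ m := by
    have := Real.rpow_nonneg (norm_nonneg x) m
    rcases max_choice 1 ‖x‖ with h | h <;> rw [h]
    · rw [Real.one_rpow]; linarith
    · linarith
  have hym : ‖y‖ ^ m ≤ 4 ^ m * ℓ ^ (-m) * (1 + ‖x‖ ^ m) := calc
    ‖y‖ ^ m ≤ (4 * ℓ⁻¹ * max 1 ‖x‖) ^ m := Real.rpow_le_rpow (norm_nonneg _) hy hm
    _ = 4 ^ m * ℓ ^ (-m) * (max 1 ‖x‖) ^ m := by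
      rw [Real.mul_rpow (by positivity) (by positivity), Real.mul_rpow (by positivity)
        (by positivity), Real.inv_rpow hℓ.le, Real.rpow_neg hℓ.le]
    _ ≤ _ := by gcongr
  have hl : 1 ≤ ℓ ^ (-m) := Real.one_le_rpow_of_pos_of_le_one_of_nonpos hℓ hℓ1 (by linarith)
  have hx : 1 ≤ 1 + ‖x‖ ^ m := by have := Real.rpow_nonneg (norm_nonneg x) m; linarith
  have := one_le_mul_of_one_le_of_one_le hl hx
  linarith

/-! ## Statement 18 -/
theorem stmt_18 (χ : E3 → ℝ) (hχ : IsCutoff χ) (m : ℝ) (hm : 0 ≤ m) :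
    ∃ c > (0:ℝ), ∀ ℓ : ℝ, 0 < ℓ → ℓ ≤ 1 → ∀ M : ℝ, 1 ≤ M →
      ∀ ω : E3 → E3, Measurable ω → (∀ x, ‖ω x‖ ≤ M * (1 + ‖x‖ ^ m)) →
      ∀ x, ‖BSreg χ ℓ ω x‖ ≤ c * ℓ ^ (-m - 1) * M * (1 + ‖x‖ ^ m) := by
  obtain ⟨K, hK, hker⟩ := hχ.exists_norm_BSker_le
  have hI : 0 ≤ ∫ z, truncInvSq z := integral_nonneg truncInvSq_nonneg
  refine ⟨(4 * Real.pi)⁻¹ * ((1 + 4 ^ m) * K * ∫ z, truncInvSq z) + 1, by positivity, ?_⟩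
  intro ℓ hℓ hℓ1 M hM ω _ hω x
  have hbound : ∀ᵐ y : E3, ‖cross3 (ω y) (BSker χ ℓ x y)‖ ≤
      M * ((1 + 4 ^ m) * ℓ ^ (-m) * (1 + ‖x‖ ^ m)) * (K * ℓ ^ 2) *
        truncInvSq (ℓ • (x - y)) := by
    filter_upwards [Measure.ae_ne volume x] with y hy
    have hk := hker ℓ hℓ x y hy.symm
    have htrunc := truncInvSq_nonneg (ℓ • (x - y))
    refine (norm_cross3_le _ _).trans ?_
    rw [mul_assoc _ (K * ℓ ^ 2)]
    rcases le_or_gt ‖ℓ • (x - y)‖ 3 with h | h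
    · have hpoly := one_add_norm_rpow_le hm hℓ hℓ1 h
      gcongr
      exact (hω y).trans (by gcongr)
    · rw [hχ.BSker_eq_zero (by linarith), norm_zero, mul_zero]
      positivity
  have hint := norm_integral_le_of_norm_le
    ((integrable_truncInvSq_smul_sub hℓ x).const_mul _) hbound
  rw [integral_const_mul, integral_truncInvSq_smul_sub hℓ] at hint
  have hpow : ℓ ^ (-m - 1) = ℓ ^ (-m) * ℓ⁻¹ := by
    rw [Real.rpow_sub hℓ, Real.rpow_one, div_eq_mul_inv]
  rw [BSreg, norm_smul, Real.norm_of_nonneg (by positivity)]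
  calc (4 * Real.pi)⁻¹ * ‖∫ y, cross3 (ω y) (BSker χ ℓ x y)‖
      ≤ (4 * Real.pi)⁻¹ * (M * ((1 + 4 ^ m) * ℓ ^ (-m) * (1 + ‖x‖ ^ m)) * (K * ℓ ^ 2) *
          ((ℓ ^ 3)⁻¹ * ∫ z, truncInvSq z)) := by gcongr
    _ = (4 * Real.pi)⁻¹ * ((1 + 4 ^ m) * K * ∫ z, truncInvSq z) * ℓ ^ (-m - 1) * M *
          (1 + ‖x‖ ^ m) := by
      rw [hpow]
      field_simp
    _ ≤ _ := by
      gcongr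
      linarith

end
end

section
/- There exists a complex-valued Schwartz function R ∈ 𝒮(ℝ³;ℂ), depending only on the cut-off χ, with the following property: for every v₀, a ∈ ℝ³ ∖ {0}, every ℓ ∈ (0,1], and the vector field ω(y) := v₀ e^{i a·y}, one has BS_ℓ[ω](x) = i e^{i a·x} ( (a/|a|²) × v₀ ) ( 1 + R(a/ℓ) ) for every x ∈ ℝ³. -/
noncomputable section

open scoped RealInnerProductSpace BigOperators
open MeasureTheory

variable {N : ℕ}

/-- The regularization `(ε² + |z|²)^{-1/2}` of the Newton kernel `1/|z|`. -/
def regKernel (ε : ℝ) (z : E3) : ℝ := (Real.sqrt (ε ^ 2 + ‖z‖ ^ 2))⁻¹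

lemma sq_add_norm_sq_pos {ε : ℝ} (hε : 0 < ε) (z : E3) : 0 < ε ^ 2 + ‖z‖ ^ 2 := by positivity

lemma regKernel_nonneg (ε : ℝ) (z : E3) : 0 ≤ regKernel ε z := by
  unfold regKernel; positivity

lemma regKernel_sq {ε : ℝ} (hε : 0 < ε) (z : E3) :
    regKernel ε z ^ 2 * (ε ^ 2 + ‖z‖ ^ 2) = 1 := by
  have := sq_add_norm_sq_pos hε z
  rw [regKernel, inv_pow, Real.sq_sqrt this.le, inv_mul_cancel₀ this.ne']

lemma regKernel_le (ε : ℝ) {z : E3} (hz : z ≠ 0) : regKernel ε z ≤ ‖z‖⁻¹ := by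
  have : 0 < ‖z‖ := norm_pos_iff.2 hz
  exact inv_anti₀ this (Real.le_sqrt_of_sq_le (by nlinarith [sq_nonneg ε]))

lemma tendsto_regKernel {z : E3} (hz : z ≠ 0) :
    Filter.Tendsto (fun c : ℝ => regKernel c⁻¹ z) Filter.atTop (nhds ‖z‖⁻¹) := by
  have h : Filter.Tendsto (fun c : ℝ => (Real.sqrt ((c⁻¹) ^ 2 + ‖z‖ ^ 2))⁻¹) Filter.atTop
      (nhds (Real.sqrt (0 ^ 2 + ‖z‖ ^ 2))⁻¹) := by
    refine Filter.Tendsto.inv₀ ?_ (by simpa using hz)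
    exact (Real.continuous_sqrt.tendsto _).comp
      ((tendsto_inv_atTop_zero.pow 2).add tendsto_const_nhds)
  simpa [regKernel] using h

lemma contDiff_regKernel {ε : ℝ} (hε : 0 < ε) {n : WithTop ℕ∞} :
    ContDiff ℝ n (regKernel ε) := by
  have h : ContDiff ℝ n fun z : E3 => ε ^ 2 + ‖z‖ ^ 2 :=
    contDiff_const.add (contDiff_norm_sq ℝ)
  exact (h.sqrt fun z => (sq_add_norm_sq_pos hε z).ne').inv
    fun z => (Real.sqrt_pos.2 (sq_add_norm_sq_pos hε z)).ne'

lemma hasFDerivAt_regKernel {ε : ℝ} (hε : 0 < ε) (z : E3) :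
    HasFDerivAt (regKernel ε) (-(regKernel ε z ^ 3) • innerSL ℝ z) z := by
  have hp := sq_add_norm_sq_pos hε z
  have h1 : HasFDerivAt (fun z : E3 => ε ^ 2 + ‖z‖ ^ 2) (2 • innerSL ℝ z) z :=
    ((hasStrictFDerivAt_norm_sq z).hasFDerivAt).const_add _
  have h2 := (h1.sqrt hp.ne')
  have h3 := (hasDerivAt_inv (Real.sqrt_pos.2 hp).ne').comp_hasFDerivAt z h2
  refine h3.congr_fderiv ?_
  ext v
  have hs : Real.sqrt (ε ^ 2 + ‖z‖ ^ 2) ≠ 0 := (Real.sqrt_pos.2 hp).ne'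
  simp [regKernel]
  field_simp

lemma fderiv_regKernel {ε : ℝ} (hε : 0 < ε) (z v : E3) :
    fderiv ℝ (regKernel ε) z v = -(⟪z, v⟫ * regKernel ε z ^ 3) := by
  rw [(hasFDerivAt_regKernel hε z).fderiv]
  simp [mul_comm]

lemma fderiv_fderiv_regKernel {ε : ℝ} (hε : 0 < ε) (z v : E3) :
    fderiv ℝ (fun y => fderiv ℝ (regKernel ε) y v) z v
      = -(‖v‖ ^ 2 * regKernel ε z ^ 3) + 3 * ⟪z, v⟫ ^ 2 * regKernel ε z ^ 5 := by
  simp_rw [fderiv_regKernel hε]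
  have h1 : HasFDerivAt (fun y : E3 => ⟪y, v⟫) (innerSL ℝ v) z := by
    simpa [real_inner_comm] using (innerSL ℝ v).hasFDerivAt (x := z)
  have h2 := (h1.mul ((hasFDerivAt_regKernel hε z).pow 3)).neg
  have h3 : HasFDerivAt (fun y : E3 => -(⟪y, v⟫ * regKernel ε y ^ 3)) _ z := h2
  rw [h3.fderiv]
  simp
  ring

lemma laplacian_regKernel {ε : ℝ} (hε : 0 < ε) (z : E3) :
    ∑ j : Fin 3, fderiv ℝ (fun y => fderiv ℝ (regKernel ε) y (e3 j)) z (e3 j)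
      = -(3 * ε ^ 2 * regKernel ε z ^ 5) := by
  have hz : ‖z‖ ^ 2 = z 0 ^ 2 + z 1 ^ 2 + z 2 ^ 2 := by
    simp [EuclideanSpace.norm_sq_eq, Fin.sum_univ_three]
  simp_rw [fderiv_fderiv_regKernel hε]
  have := regKernel_sq hε z
  simp [e3, Fin.sum_univ_three, EuclideanSpace.inner_single_right]
  rw [hz] at this
  linear_combination (3 * regKernel ε z ^ 3) * this

lemma regKernel_inv {c : ℝ} (hc : 0 < c) (z : E3) :
    regKernel c⁻¹ z = c * regKernel 1 (c • z) := by
  have : (1:ℝ) ^ 2 + ‖c • z‖ ^ 2 = c ^ 2 * ((c⁻¹) ^ 2 + ‖z‖ ^ 2) := by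
    rw [norm_smul, Real.norm_of_nonneg hc.le]; field_simp
  rw [regKernel, regKernel, this, Real.sqrt_mul (by positivity), Real.sqrt_sq hc.le]
  field_simp

lemma integral_regKernel_one_pow_five : ∫ z : E3, regKernel 1 z ^ 5 = 4 * Real.pi / 3 := by
  have h := integral_fun_norm_addHaar (volume : Measure E3)
    (fun r : ℝ => (Real.sqrt (1 ^ 2 + r ^ 2))⁻¹ ^ 5)
  have hv : (volume : Measure E3).real (Metric.ball 0 1) = 4 * Real.pi / 3 := by
    rw [Measure.real, EuclideanSpace.volume_ball_fin_three]
    rw [ENNReal.ofReal_one, one_pow, one_mul, ENNReal.toReal_ofReal (by positivity)]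
    ring
  have hd : ∀ r : ℝ, HasDerivAt (fun r : ℝ => r ^ 3 * (Real.sqrt (1 + r ^ 2))⁻¹ ^ 3 / 3)
      (r ^ 2 * (Real.sqrt (1 + r ^ 2))⁻¹ ^ 5) r := by
    intro r
    have hp : 0 < 1 + r ^ 2 := by positivity
    have h1 : HasDerivAt (fun r : ℝ => 1 + r ^ 2) (2 * r) r := by
      simpa using (hasDerivAt_pow 2 r).const_add 1
    have hs := Real.sqrt_pos.2 hp
    have h2 := (((hasDerivAt_pow 3 r).mul (((h1.sqrt hp.ne').inv hs.ne').pow 3)).div_const 3)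
    refine h2.congr_deriv ?_
    have := Real.sq_sqrt hp.le
    simp
    field_simp
    rw [this]
    ring
  have ht : Filter.Tendsto (fun r : ℝ => r ^ 3 * (Real.sqrt (1 + r ^ 2))⁻¹ ^ 3 / 3)
      Filter.atTop (nhds (1 / 3)) := by
    have h0 : Filter.Tendsto (fun r : ℝ => (Real.sqrt ((r⁻¹) ^ 2 + 1))⁻¹ ^ 3 / 3)
        Filter.atTop (nhds ((Real.sqrt (0 ^ 2 + 1))⁻¹ ^ 3 / 3)) := by
      refine ((Filter.Tendsto.inv₀ ?_ (by simp)).pow 3).div_const 3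
      exact (Real.continuous_sqrt.tendsto _).comp
        ((tendsto_inv_atTop_zero.pow 2).add tendsto_const_nhds)
    simp only [ne_eq, OfNat.ofNat_ne_zero, not_false_eq_true, zero_pow, zero_add, Real.sqrt_one,
      inv_one, one_pow] at h0
    refine h0.congr' ?_
    filter_upwards [Filter.eventually_gt_atTop 0] with r hr
    have : 1 + r ^ 2 = r ^ 2 * ((r⁻¹) ^ 2 + 1) := by field_simp
    rw [this, Real.sqrt_mul (by positivity), Real.sqrt_sq hr.le]
    have : Real.sqrt ((r⁻¹) ^ 2 + 1) ≠ 0 := by positivity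
    field_simp
  have hi := integral_Ioi_of_hasDerivAt_of_nonneg' (a := 0) (fun r _ => hd r)
    (fun r _ => by positivity) ht
  simp only [regKernel]
  rw [h, hv]
  simp at hi ⊢
  rw [hi]
  ring

lemma locallyIntegrable_inv_norm_pow {k : ℕ} (hk : k ≤ 2) :
    LocallyIntegrable (fun z : E3 => ‖z‖⁻¹ ^ k) := by
  intro x
  refine ⟨Metric.ball 0 (‖x‖ + 1), Metric.isOpen_ball.mem_nhds (by simp), ?_⟩
  rw [integrableOn_fun_norm_addHaar (volume : Measure E3) (f := fun r => r⁻¹ ^ k)]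
  have hc : IntegrableOn (fun y : ℝ => y ^ (2 - k)) (Set.Ioo 0 (‖x‖ + 1)) :=
    ((continuous_pow _).integrableOn_Icc).mono_set Set.Ioo_subset_Icc_self
  refine hc.congr_fun (fun y hy => ?_) measurableSet_Ioo
  have : y ≠ 0 := hy.1.ne'
  simp only [finrank_euclideanSpace, Fintype.card_fin, smul_eq_mul]
  rw [pow_sub₀ _ this hk, inv_pow]

lemma integrable_inv_norm_pow_smul {k : ℕ} (hk : k ≤ 2) {φ : E3 → ℂ} (hφ : Continuous φ)
    (hφc : HasCompactSupport φ) : Integrable fun z : E3 => (‖z‖⁻¹ ^ k) • φ z :=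
  (locallyIntegrable_inv_norm_pow hk).integrable_smul_right_of_hasCompactSupport hφ hφc

lemma ae_ne_zero_E3 : ∀ᵐ z : E3, z ≠ 0 := by
  simp [ae_iff]

lemma tendsto_integral_smul_of_le_inv_norm_pow {k : ℕ} (hk : k ≤ 2) {C : ℝ} {F : ℝ → E3 → ℝ}
    {G : E3 → ℝ} (hF : ∀ᶠ c in Filter.atTop, Continuous (F c))
    (hb : ∀ᶠ c in Filter.atTop, ∀ z : E3, z ≠ 0 → ‖F c z‖ ≤ C * ‖z‖⁻¹ ^ k)
    (hl : ∀ z : E3, z ≠ 0 → Filter.Tendsto (F · z) Filter.atTop (nhds (G z)))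
    {φ : E3 → ℂ} (hφ : Continuous φ) (hφc : HasCompactSupport φ) :
    Filter.Tendsto (fun c => ∫ z, F c z • φ z) Filter.atTop (nhds (∫ z, G z • φ z)) := by
  refine tendsto_integral_filter_of_dominated_convergence
    (fun z => C * ‖(‖z‖⁻¹ ^ k) • φ z‖) ?_ ?_ ?_ ?_
  · filter_upwards [hF] with c hc using (hc.smul hφ).aestronglyMeasurable
  · filter_upwards [hb] with c hc
    filter_upwards [ae_ne_zero_E3] with z hz
    rw [norm_smul, norm_smul, ← mul_assoc, Real.norm_of_nonneg (by positivity : 0 ≤ ‖z‖⁻¹ ^ k)]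
    exact mul_le_mul_of_nonneg_right (hc z hz) (norm_nonneg _)
  · exact (integrable_inv_norm_pow_smul hk hφ hφc).norm.const_mul C
  · filter_upwards [ae_ne_zero_E3] with z hz using (hl z hz).smul_const _

lemma integral_smul_fderiv_of_hasCompactSupport {f : E3 → ℝ} (hf : ContDiff ℝ 1 f) {ψ : E3 → ℂ}
    (hψ : ContDiff ℝ 1 ψ) (hψc : HasCompactSupport ψ) (v : E3) :
    ∫ z, f z • fderiv ℝ ψ z v = -∫ z, fderiv ℝ f z v • ψ z := by
  have hf' : Continuous fun z => fderiv ℝ f z v :=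
    (hf.continuous_fderiv one_ne_zero).clm_apply continuous_const
  have hψ' : Continuous fun z => fderiv ℝ ψ z v :=
    (hψ.continuous_fderiv one_ne_zero).clm_apply continuous_const
  refine integral_bilinear_fderiv_right_eq_neg_left_of_integrable
    (B := ContinuousLinearMap.lsmul ℝ ℝ) ?_ ?_ ?_ (fun z _ => hf.differentiable one_ne_zero z)
    (fun z _ => hψ.differentiable one_ne_zero z)
  · exact (hf'.smul hψ.continuous).integrable_of_hasCompactSupport hψc.smul_left
  · exact (hf.continuous.smul hψ').integrable_of_hasCompactSupport
      (hψc.fderiv_apply (𝕜 := ℝ) v).smul_left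
  · exact (hf.continuous.smul hψ.continuous).integrable_of_hasCompactSupport hψc.smul_left

/-- Weak differentiation of the Newton kernel `1/|z|`. -/
lemma integral_inv_norm_smul_fderiv {ψ : E3 → ℂ} (hψ : ContDiff ℝ 1 ψ)
    (hψc : HasCompactSupport ψ) (v : E3) :
    ∫ z : E3, ‖z‖⁻¹ • fderiv ℝ ψ z v = ∫ z : E3, (⟪z, v⟫ * ‖z‖⁻¹ ^ 3) • ψ z := by
  have hψ' : Continuous fun z => fderiv ℝ ψ z v :=
    (hψ.continuous_fderiv one_ne_zero).clm_apply continuous_const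
  have hpos : ∀ᶠ c : ℝ in Filter.atTop, 0 < c⁻¹ := by
    filter_upwards [Filter.eventually_gt_atTop 0] with c hc using inv_pos.2 hc
  have h1 : Filter.Tendsto (fun c : ℝ => ∫ z, regKernel c⁻¹ z • fderiv ℝ ψ z v) Filter.atTop
      (nhds (∫ z : E3, ‖z‖⁻¹ • fderiv ℝ ψ z v)) := by
    refine tendsto_integral_smul_of_le_inv_norm_pow (k := 1) (C := 1) (by norm_num) ?_ ?_ ?_
      hψ' (hψc.fderiv_apply (𝕜 := ℝ) v)
    · filter_upwards [hpos] with c hc using (contDiff_regKernel (n := 1) hc).continuous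
    · refine Filter.Eventually.of_forall fun c z hz => ?_
      rw [Real.norm_of_nonneg (regKernel_nonneg _ _)]
      simpa using regKernel_le c⁻¹ hz
    · exact fun z hz => tendsto_regKernel hz
  have h2 : Filter.Tendsto (fun c : ℝ => ∫ z, (⟪z, v⟫ * regKernel c⁻¹ z ^ 3) • ψ z) Filter.atTop
      (nhds (∫ z : E3, (⟪z, v⟫ * ‖z‖⁻¹ ^ 3) • ψ z)) := by
    refine tendsto_integral_smul_of_le_inv_norm_pow (k := 2) (C := ‖v‖) le_rfl ?_ ?_ ?_
      hψ.continuous hψc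
    · filter_upwards [hpos] with c hc
      have := (contDiff_regKernel (n := 1) hc).continuous
      fun_prop
    · refine Filter.Eventually.of_forall fun c z hz => ?_
      have hz' : ‖z‖ ≠ 0 := norm_ne_zero_iff.2 hz
      rw [norm_mul, norm_pow, Real.norm_of_nonneg (regKernel_nonneg _ _)]
      calc ‖⟪z, v⟫‖ * regKernel c⁻¹ z ^ 3 ≤ (‖z‖ * ‖v‖) * ‖z‖⁻¹ ^ 3 := by
            have := regKernel_nonneg c⁻¹ z
            exact mul_le_mul (norm_inner_le_norm (𝕜 := ℝ) z v)
              (pow_le_pow_left₀ this (regKernel_le _ hz) 3) (by positivity) (by positivity)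
        _ = ‖v‖ * ‖z‖⁻¹ ^ 2 := by field_simp
    · exact fun z hz => ((tendsto_regKernel hz).pow 3).const_mul _
  refine tendsto_nhds_unique (h1.congr' ?_) h2
  filter_upwards [hpos] with c hc
  rw [integral_smul_fderiv_of_hasCompactSupport (contDiff_regKernel hc) hψ hψc,
    ← integral_neg]
  simp_rw [fderiv_regKernel hc, neg_smul, neg_neg]

/-- `1/(4π|z|)` is the fundamental solution of `-Δ` on `ℝ³`. -/
lemma integral_inv_norm_smul_laplacian {ψ : E3 → ℂ} (hψ : ContDiff ℝ 2 ψ)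
    (hψc : HasCompactSupport ψ) :
    ∫ z : E3, ‖z‖⁻¹ • ∑ j : Fin 3, fderiv ℝ (fun y => fderiv ℝ ψ y (e3 j)) z (e3 j)
      = -(4 * Real.pi) * ψ 0 := by
  have hψ1 : ∀ j, ContDiff ℝ 1 fun z => fderiv ℝ ψ z (e3 j) := fun j =>
    (hψ.fderiv_right (m := 1) (by norm_num)).clm_apply contDiff_const
  have hc1 : ∀ j, HasCompactSupport fun z => fderiv ℝ ψ z (e3 j) := fun j =>
    hψc.fderiv_apply (𝕜 := ℝ) (e3 j)
  have hψ2 : ∀ j, Continuous fun z => fderiv ℝ (fun y => fderiv ℝ ψ y (e3 j)) z (e3 j) := fun j =>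
    ((hψ1 j).continuous_fderiv one_ne_zero).clm_apply continuous_const
  have hc2 : ∀ j, HasCompactSupport fun z => fderiv ℝ (fun y => fderiv ℝ ψ y (e3 j)) z (e3 j) :=
    fun j => (hc1 j).fderiv_apply (𝕜 := ℝ) (e3 j)
  have hpos : ∀ᶠ c : ℝ in Filter.atTop, 0 < c⁻¹ := by
    filter_upwards [Filter.eventually_gt_atTop 0] with c hc using inv_pos.2 hc
  have h1 : Filter.Tendsto (fun c : ℝ => ∫ z, regKernel c⁻¹ z •
      ∑ j : Fin 3, fderiv ℝ (fun y => fderiv ℝ ψ y (e3 j)) z (e3 j)) Filter.atTop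
      (nhds (∫ z : E3, ‖z‖⁻¹ •
        ∑ j : Fin 3, fderiv ℝ (fun y => fderiv ℝ ψ y (e3 j)) z (e3 j))) := by
    refine tendsto_integral_smul_of_le_inv_norm_pow (k := 1) (C := 1) (by norm_num) ?_ ?_ ?_
      (continuous_finsetSum _ fun j _ => hψ2 j) ?_
    · filter_upwards [hpos] with c hc using (contDiff_regKernel (n := 1) hc).continuous
    · refine Filter.Eventually.of_forall fun c z hz => ?_
      rw [Real.norm_of_nonneg (regKernel_nonneg _ _)]
      simpa using regKernel_le c⁻¹ hz
    · exact fun z hz => tendsto_regKernel hz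
    · simp_rw [Fin.sum_univ_three]
      exact ((hc2 0).add (hc2 1)).add (hc2 2)
  have hφ : ∫ z : E3, 3 / (4 * Real.pi) * regKernel 1 z ^ 5 = 1 := by
    rw [integral_const_mul, integral_regKernel_one_pow_five]
    field_simp
  have h2 := tendsto_integral_comp_smul_smul_of_integrable (μ := (volume : Measure E3))
    (φ := fun z => 3 / (4 * Real.pi) * regKernel 1 z ^ 5)
    (fun z => by have := regKernel_nonneg 1 z; positivity) hφ ?_
    (hψ.continuous.integrable_of_hasCompactSupport hψc) hψ.continuous.continuousAt
  · refine tendsto_nhds_unique (h1.congr' ?_) (h2.const_mul (-(4 * Real.pi : ℂ)))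
    filter_upwards [Filter.eventually_gt_atTop 0] with c hc0
    have hc : 0 < c⁻¹ := inv_pos.2 hc0
    have hg : ContDiff ℝ 2 (regKernel c⁻¹) := contDiff_regKernel hc
    have hg1 : ∀ j, ContDiff ℝ 1 fun z => fderiv ℝ (regKernel c⁻¹) z (e3 j) := fun j =>
      (hg.fderiv_right (m := 1) (by norm_num)).clm_apply contDiff_const
    have hg2 : ∀ j, Continuous fun z =>
        fderiv ℝ (fun y => fderiv ℝ (regKernel c⁻¹) y (e3 j)) z (e3 j) := fun j =>
      ((hg1 j).continuous_fderiv one_ne_zero).clm_apply continuous_const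
    have hparts : ∀ j, ∫ z, regKernel c⁻¹ z • fderiv ℝ (fun y => fderiv ℝ ψ y (e3 j)) z (e3 j)
        = ∫ z, fderiv ℝ (fun y => fderiv ℝ (regKernel c⁻¹) y (e3 j)) z (e3 j) • ψ z := fun j => by
      rw [integral_smul_fderiv_of_hasCompactSupport (hg.of_le (by norm_num)) (hψ1 j) (hc1 j),
        integral_smul_fderiv_of_hasCompactSupport (hg1 j) (hψ.of_le (by norm_num)) hψc, neg_neg]
    simp_rw [Finset.smul_sum]
    have hi1 : ∀ j, Integrable fun z => regKernel c⁻¹ z •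
        fderiv ℝ (fun y => fderiv ℝ ψ y (e3 j)) z (e3 j) := fun j =>
      (hg.continuous.smul (hψ2 j)).integrable_of_hasCompactSupport (hc2 j).smul_left
    have hi2 : ∀ j, Integrable fun z =>
        fderiv ℝ (fun y => fderiv ℝ (regKernel c⁻¹) y (e3 j)) z (e3 j) • ψ z := fun j =>
      ((hg2 j).smul hψ.continuous).integrable_of_hasCompactSupport hψc.smul_left
    rw [integral_finsetSum _ fun j _ => hi1 j]
    simp_rw [hparts]
    rw [← integral_finsetSum _ fun j _ => hi2 j, ← integral_const_mul]
    congr 1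
    ext z
    rw [← Finset.sum_smul, laplacian_regKernel hc, regKernel_inv hc0]
    simp only [finrank_euclideanSpace, Fintype.card_fin, Complex.real_smul]
    push_cast
    have : (c : ℂ) ≠ 0 := by exact_mod_cast hc0.ne'
    have : (Real.pi : ℂ) ≠ 0 := by exact_mod_cast Real.pi_ne_zero
    field_simp
  · have hlim : Filter.Tendsto (fun z : E3 => 3 / (4 * Real.pi) * ‖z‖⁻¹ ^ 2)
        (Bornology.cobounded E3) (nhds (3 / (4 * Real.pi) * 0 ^ 2)) :=
      ((tendsto_inv_atTop_zero.comp tendsto_norm_cobounded_atTop).pow 2).const_mul _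
    rw [zero_pow two_ne_zero, mul_zero] at hlim
    refine squeeze_zero (fun z => by have := regKernel_nonneg 1 z; positivity) (fun z => ?_) hlim
    rcases eq_or_ne z 0 with rfl | hz
    · simp
    have hz' : 0 < ‖z‖ := norm_pos_iff.2 hz
    calc ‖z‖ ^ Module.finrank ℝ E3 * (3 / (4 * Real.pi) * regKernel 1 z ^ 5)
        ≤ ‖z‖ ^ Module.finrank ℝ E3 * (3 / (4 * Real.pi) * ‖z‖⁻¹ ^ 5) := by
          gcongr
          · exact regKernel_nonneg _ _
          · exact regKernel_le _ hz
      _ = 3 / (4 * Real.pi) * ‖z‖⁻¹ ^ 2 := by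
          simp only [finrank_euclideanSpace, Fintype.card_fin]
          field_simp

/-- The plane wave `z ↦ e^{-i b·z}`. -/
def planeWave (b z : E3) : ℂ := Complex.exp (-(Complex.I * (⟪b, z⟫ : ℝ)))

lemma hasFDerivAt_planeWave (b z : E3) :
    HasFDerivAt (planeWave b)
      (planeWave b z • -(Complex.I • Complex.ofRealCLM.comp (innerSL ℝ b))) z := by
  have h : HasFDerivAt (fun z => -(Complex.I * (⟪b, z⟫ : ℝ)))
      (-(Complex.I • Complex.ofRealCLM.comp (innerSL ℝ b))) z :=
    (((Complex.ofRealCLM.comp (innerSL ℝ b)).hasFDerivAt (x := z)).const_mul Complex.I).neg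
  exact h.cexp

lemma contDiff_planeWave (b : E3) {n : WithTop ℕ∞} : ContDiff ℝ n (planeWave b) := by
  have h : ContDiff ℝ n fun z => -(Complex.I * (⟪b, z⟫ : ℝ)) :=
    (contDiff_const.mul (Complex.ofRealCLM.comp (innerSL ℝ b)).contDiff).neg
  exact h.cexp

lemma fderiv_mul_planeWave {ρ : E3 → ℂ} {z : E3} (hρ : DifferentiableAt ℝ ρ z) (b v : E3) :
    fderiv ℝ (fun y => ρ y * planeWave b y) z v
      = (fderiv ℝ ρ z v - Complex.I * (⟪b, v⟫ : ℝ) * ρ z) * planeWave b z := by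
  have h : HasFDerivAt (fun y => ρ y * planeWave b y) _ z :=
    hρ.hasFDerivAt.mul (hasFDerivAt_planeWave b z)
  rw [h.fderiv]
  simp
  ring

lemma fderiv_fderiv_mul_planeWave {ρ : E3 → ℂ} (hρ : ContDiff ℝ 2 ρ) (b v z : E3) :
    fderiv ℝ (fun y => fderiv ℝ (fun x => ρ x * planeWave b x) y v) z v
      = (fderiv ℝ (fun y => fderiv ℝ ρ y v) z v - 2 * (Complex.I * (⟪b, v⟫ : ℝ) * fderiv ℝ ρ z v)
          - (⟪b, v⟫ : ℝ) ^ 2 * ρ z) * planeWave b z := by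
  have hd : Differentiable ℝ ρ := hρ.differentiable two_ne_zero
  have hd1 : Differentiable ℝ fun y => fderiv ℝ ρ y v :=
    ((hρ.fderiv_right (m := 1) (by norm_num)).clm_apply contDiff_const).differentiable one_ne_zero
  simp_rw [fun y => fderiv_mul_planeWave (hd y) b v]
  have hd2 : DifferentiableAt ℝ (fun y => fderiv ℝ ρ y v - Complex.I * (⟪b, v⟫ : ℝ) * ρ y) z :=
    (hd1 z).sub ((hd z).const_mul _)
  rw [fderiv_mul_planeWave hd2,
    fderiv_fun_sub (hd1 z) ((hd z).const_mul _), fderiv_const_mul (hd z)]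
  simp only [sub_apply, FunLike.coe_smul, Pi.smul_apply, smul_eq_mul]
  linear_combination ((⟪b, v⟫ : ℝ) ^ 2 * ρ z * planeWave b z) * Complex.I_sq

lemma integrable_inv_norm_smul_mul_planeWave {ρ : E3 → ℂ} (hρ : Continuous ρ)
    (hc : HasCompactSupport ρ) (b : E3) :
    Integrable fun z : E3 => (‖z‖⁻¹ • ρ z) * planeWave b z := by
  have := integrable_inv_norm_pow_smul (k := 1) (by norm_num)
    (hρ.mul (contDiff_planeWave b (n := 1)).continuous) hc.mul_right
  simpa [mul_assoc] using this

lemma integrable_inner_mul_inv_norm_smul {ρ : E3 → ℂ} (hρ : Continuous ρ)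
    (hc : HasCompactSupport ρ) (v : E3) :
    Integrable fun z : E3 => (⟪z, v⟫ * ‖z‖⁻¹ ^ 3) • ρ z := by
  have h := (integrable_inv_norm_pow_smul (k := 2) le_rfl hρ hc).norm.const_mul ‖v‖
  have hm : Measurable fun z : E3 => ⟪z, v⟫ * ‖z‖⁻¹ ^ 3 := by fun_prop
  refine h.mono' (hm.aestronglyMeasurable.smul hρ.aestronglyMeasurable) ?_
  filter_upwards [ae_ne_zero_E3] with z hz
  have hz' : ‖z‖ ≠ 0 := norm_ne_zero_iff.2 hz
  rw [norm_smul, norm_smul, ← mul_assoc]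
  refine mul_le_mul_of_nonneg_right ?_ (norm_nonneg _)
  rw [norm_mul, Real.norm_of_nonneg (by positivity : 0 ≤ ‖z‖⁻¹ ^ 3),
    Real.norm_of_nonneg (by positivity : 0 ≤ ‖z‖⁻¹ ^ 2)]
  calc ‖⟪z, v⟫‖ * ‖z‖⁻¹ ^ 3 ≤ (‖z‖ * ‖v‖) * ‖z‖⁻¹ ^ 3 :=
        mul_le_mul_of_nonneg_right (norm_inner_le_norm (𝕜 := ℝ) z v) (by positivity)
    _ = ‖v‖ * ‖z‖⁻¹ ^ 2 := by field_simp

/-- The derivative of `ρ(z)/|z|` in the direction `v`, away from the origin. -/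
def newtonDeriv (ρ : E3 → ℂ) (v z : E3) : ℂ :=
  ‖z‖⁻¹ • fderiv ℝ ρ z v - (⟪z, v⟫ * ‖z‖⁻¹ ^ 3) • ρ z

lemma integrable_newtonDeriv_mul_planeWave {ρ : E3 → ℂ} (hρ : ContDiff ℝ 1 ρ)
    (hc : HasCompactSupport ρ) (b v : E3) :
    Integrable fun z : E3 => newtonDeriv ρ v z * planeWave b z := by
  have hw := (contDiff_planeWave b (n := 1)).continuous
  have hρ' : Continuous fun z => fderiv ℝ ρ z v :=
    (hρ.continuous_fderiv one_ne_zero).clm_apply continuous_const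
  have h := (integrable_inv_norm_smul_mul_planeWave hρ' (hc.fderiv_apply (𝕜 := ℝ) v) b).sub
    (integrable_inner_mul_inv_norm_smul (hρ.continuous.mul hw) hc.mul_right v)
  refine h.congr (Filter.Eventually.of_forall fun z => ?_)
  simp [newtonDeriv]
  ring

lemma integral_newtonDeriv_mul_planeWave {ρ : E3 → ℂ} (hρ : ContDiff ℝ 1 ρ)
    (hc : HasCompactSupport ρ) (b v : E3) :
    ∫ z : E3, newtonDeriv ρ v z * planeWave b z
      = Complex.I * (⟪b, v⟫ : ℝ) * ∫ z : E3, (‖z‖⁻¹ • ρ z) * planeWave b z := by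
  have hw := (contDiff_planeWave b (n := 1))
  have hρ' : Continuous fun z => fderiv ℝ ρ z v :=
    (hρ.continuous_fderiv one_ne_zero).clm_apply continuous_const
  have h := integral_inv_norm_smul_fderiv (hρ.mul hw) hc.mul_right v
  have hi1 := integrable_inv_norm_smul_mul_planeWave hρ' (hc.fderiv_apply (𝕜 := ℝ) v) b
  have hi2 : Integrable fun z => (⟪z, v⟫ * ‖z‖⁻¹ ^ 3) • (ρ z * planeWave b z) :=
    integrable_inner_mul_inv_norm_smul (hρ.continuous.mul hw.continuous) hc.mul_right v
  have hi3 := (integrable_inv_norm_smul_mul_planeWave hρ.continuous hc b).const_mul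
    (Complex.I * (⟪b, v⟫ : ℝ))
  have e1 : ∀ z, newtonDeriv ρ v z * planeWave b z = (‖z‖⁻¹ • fderiv ℝ ρ z v) * planeWave b z
      - (⟪z, v⟫ * ‖z‖⁻¹ ^ 3) • (ρ z * planeWave b z) := fun z => by
    simp [newtonDeriv]; ring
  have e2 : ∀ z, ‖z‖⁻¹ • fderiv ℝ (fun y => ρ y * planeWave b y) z v
      = (‖z‖⁻¹ • fderiv ℝ ρ z v) * planeWave b z
        - Complex.I * (⟪b, v⟫ : ℝ) * ((‖z‖⁻¹ • ρ z) * planeWave b z) := fun z => by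
    rw [fderiv_mul_planeWave (hρ.differentiable one_ne_zero z)]
    simp; ring
  simp_rw [e1]
  rw [integral_sub hi1 hi2, ← h]
  simp_rw [e2]
  rw [integral_sub hi1 hi3, integral_const_mul]
  ring

lemma norm_sq_mul_integral_planeWave {ρ : E3 → ℂ} (hρ : ContDiff ℝ 2 ρ)
    (hc : HasCompactSupport ρ) (b : E3) :
    (‖b‖ ^ 2 : ℝ) * ∫ z : E3, (‖z‖⁻¹ • ρ z) * planeWave b z
      = 4 * Real.pi * ρ 0 + ∑ j : Fin 3,
        ((∫ z : E3, (‖z‖⁻¹ • fderiv ℝ (fun y => fderiv ℝ ρ y (e3 j)) z (e3 j)) * planeWave b z)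
          - 2 * (Complex.I * (⟪b, e3 j⟫ : ℝ)
            * ∫ z : E3, (‖z‖⁻¹ • fderiv ℝ ρ z (e3 j)) * planeWave b z)) := by
  have hw := (contDiff_planeWave b (n := 2))
  have hρ1 : ∀ j, ContDiff ℝ 1 fun z => fderiv ℝ ρ z (e3 j) := fun j =>
    (hρ.fderiv_right (m := 1) (by norm_num)).clm_apply contDiff_const
  have hc1 : ∀ j, HasCompactSupport fun z => fderiv ℝ ρ z (e3 j) := fun j =>
    hc.fderiv_apply (𝕜 := ℝ) (e3 j)
  have hi2 := fun j => integrable_inv_norm_smul_mul_planeWave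
    (((hρ1 j).continuous_fderiv one_ne_zero).clm_apply continuous_const)
    ((hc1 j).fderiv_apply (𝕜 := ℝ) (e3 j)) b
  have hi1 := fun j => ((integrable_inv_norm_smul_mul_planeWave (hρ1 j).continuous
    (hc1 j) b).const_mul (Complex.I * (⟪b, e3 j⟫ : ℝ))).const_mul 2
  have hi0 := fun j : Fin 3 => (integrable_inv_norm_smul_mul_planeWave hρ.continuous hc b).const_mul
    ((⟪b, e3 j⟫ : ℝ) ^ 2 : ℂ)
  have hi21 : ∀ j, Integrable fun z : E3 =>
      (‖z‖⁻¹ • fderiv ℝ (fun y => fderiv ℝ ρ y (e3 j)) z (e3 j)) * planeWave b z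
        - 2 * (Complex.I * (⟪b, e3 j⟫ : ℝ) * ((‖z‖⁻¹ • fderiv ℝ ρ z (e3 j)) * planeWave b z)) :=
    fun j => (hi2 j).sub (hi1 j)
  have hi210 : ∀ j, Integrable fun z : E3 =>
      (‖z‖⁻¹ • fderiv ℝ (fun y => fderiv ℝ ρ y (e3 j)) z (e3 j)) * planeWave b z
        - 2 * (Complex.I * (⟪b, e3 j⟫ : ℝ) * ((‖z‖⁻¹ • fderiv ℝ ρ z (e3 j)) * planeWave b z))
        - (⟪b, e3 j⟫ : ℝ) ^ 2 * ((‖z‖⁻¹ • ρ z) * planeWave b z) :=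
    fun j => (hi21 j).sub (hi0 j)
  have h := integral_inv_norm_smul_laplacian (hρ.mul hw) hc.mul_right
  have e : ∀ z, ‖z‖⁻¹ • ∑ j : Fin 3,
      fderiv ℝ (fun y => fderiv ℝ (fun x => ρ x * planeWave b x) y (e3 j)) z (e3 j)
      = ∑ j : Fin 3,
        ((‖z‖⁻¹ • fderiv ℝ (fun y => fderiv ℝ ρ y (e3 j)) z (e3 j)) * planeWave b z
          - 2 * (Complex.I * (⟪b, e3 j⟫ : ℝ) * ((‖z‖⁻¹ • fderiv ℝ ρ z (e3 j)) * planeWave b z))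
          - (⟪b, e3 j⟫ : ℝ) ^ 2 * ((‖z‖⁻¹ • ρ z) * planeWave b z)) := fun z => by
    rw [Finset.smul_sum]
    refine Finset.sum_congr rfl fun j _ => ?_
    rw [fderiv_fderiv_mul_planeWave hρ]
    simp only [Complex.real_smul]; ring
  simp_rw [e] at h
  rw [integral_finsetSum _ fun j _ => hi210 j] at h
  simp_rw [fun j => integral_sub (hi21 j) (hi0 j),
    fun j => integral_sub (hi2 j) (hi1 j), integral_const_mul] at h
  rw [Finset.sum_sub_distrib, ← Finset.sum_mul] at h
  have hb : ∑ j : Fin 3, ((⟪b, e3 j⟫ : ℝ) ^ 2 : ℂ) = (‖b‖ ^ 2 : ℝ) := by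
    simp [EuclideanSpace.norm_sq_eq, e3, EuclideanSpace.inner_single_right]
  have hw0 : planeWave b 0 = 1 := by simp [planeWave]
  rw [hb, hw0] at h
  linear_combination -h

open scoped FourierTransform ContDiff Topology in
lemma exists_schwartz_eq_integral_planeWave (P : SchwartzMap E3 ℂ) :
    ∃ Q : SchwartzMap E3 ℂ, ∀ b, Q b = ∫ z : E3, P z * planeWave b z := by
  have hc : (2 * Real.pi)⁻¹ ≠ 0 := by positivity
  refine ⟨SchwartzMap.compCLMOfContinuousLinearEquiv ℂ
    (ContinuousLinearEquiv.smulLeft (Units.mk0 _ hc)) (𝓕 P), fun b => ?_⟩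
  rw [SchwartzMap.compCLMOfContinuousLinearEquiv_apply, Function.comp_apply,
    SchwartzMap.fourier_coe, Real.fourier_eq']
  refine integral_congr_ae (.of_forall fun z => ?_)
  have h : -2 * Real.pi * ⟪z, ContinuousLinearEquiv.smulLeft (R₁ := ℝ) (Units.mk0 _ hc) b⟫
      = -⟪b, z⟫ := by
    change -2 * Real.pi * ⟪z, (2 * Real.pi)⁻¹ • b⟫ = _
    rw [real_inner_smul_right, real_inner_comm]
    field_simp
  simp only [h, planeWave, smul_eq_mul]
  rw [mul_comm (P z)]
  push_cast
  ring_nf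

lemma exists_schwartz_eq_inner_mul (Q : SchwartzMap E3 ℂ) (v : E3) :
    ∃ S : SchwartzMap E3 ℂ, ∀ b, S b = Complex.I * (⟪b, v⟫ : ℝ) * Q b := by
  have h : Function.HasTemperateGrowth fun b : E3 => Complex.I * (⟪b, v⟫ : ℝ) := by
    convert (Complex.I • Complex.ofRealCLM.comp (innerSL ℝ v)).hasTemperateGrowth using 2 with b
    simp [real_inner_comm]
  exact ⟨SchwartzMap.smulLeftCLM ℂ (fun b => Complex.I * (⟪b, v⟫ : ℝ)) Q, fun b => by
    rw [SchwartzMap.smulLeftCLM_apply_apply h, smul_eq_mul]⟩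

open scoped ContDiff Topology in
lemma exists_schwartz_eq_inv_norm_smul {f : E3 → ℂ} (hf : ContDiff ℝ ∞ f)
    (hc : HasCompactSupport f) (h0 : f =ᶠ[𝓝 0] 0) :
    ∃ P : SchwartzMap E3 ℂ, ∀ z, P z = ‖z‖⁻¹ • f z := by
  have h : ContDiff ℝ ∞ fun z => ‖z‖⁻¹ • f z := by
    refine contDiff_iff_contDiffAt.2 fun z => ?_
    rcases eq_or_ne z 0 with rfl | hz
    · refine (contDiffAt_const (c := (0 : ℂ))).congr_of_eventuallyEq ?_
      filter_upwards [h0] with z hz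
      simp [hz]
    · exact ((contDiffAt_norm ℝ hz).inv (norm_ne_zero_iff.2 hz)).smul hf.contDiffAt
  have hs : HasCompactSupport fun z => ‖z‖⁻¹ • f z := hc.mono fun z hz => right_ne_zero_of_smul hz
  exact ⟨hs.toSchwartzMap h, fun z => rfl⟩

open scoped ContDiff Topology in
lemma exists_schwartz_norm_sq_mul_integral_planeWave {ρ : E3 → ℂ} (hρ : ContDiff ℝ ∞ ρ)
    (hc : HasCompactSupport ρ) (h1 : ρ =ᶠ[𝓝 0] 1) :
    ∃ R : SchwartzMap E3 ℂ, ∀ b : E3,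
      (‖b‖ ^ 2 : ℝ) * ∫ z : E3, (‖z‖⁻¹ • ρ z) * planeWave b z = 4 * Real.pi * (1 + R b) := by
  have key : ∀ j : Fin 3, ∃ S : SchwartzMap E3 ℂ, ∀ b,
      S b = (∫ z : E3, (‖z‖⁻¹ • fderiv ℝ (fun y => fderiv ℝ ρ y (e3 j)) z (e3 j)) * planeWave b z)
          - 2 * (Complex.I * (⟪b, e3 j⟫ : ℝ)
            * ∫ z : E3, (‖z‖⁻¹ • fderiv ℝ ρ z (e3 j)) * planeWave b z) := fun j => by
    have hd : ∀ {f : E3 → ℂ}, ContDiff ℝ ∞ f → ContDiff ℝ ∞ fun z => fderiv ℝ f z (e3 j) :=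
      fun hf => (hf.fderiv_right (m := ∞) (by simp)).clm_apply contDiff_const
    have hz : ∀ {f : E3 → ℂ} {c : ℂ}, f =ᶠ[𝓝 0] (fun _ => c) →
        (fun z => fderiv ℝ f z (e3 j)) =ᶠ[𝓝 0] fun _ => 0 := fun hf => by
      filter_upwards [hf.fderiv (𝕜 := ℝ)] with z hz
      simp [hz]
    have hz1 := hz (c := 1) h1
    obtain ⟨P1, hP1⟩ := exists_schwartz_eq_inv_norm_smul (hd hρ) (hc.fderiv_apply (𝕜 := ℝ) _) hz1
    obtain ⟨P2, hP2⟩ := exists_schwartz_eq_inv_norm_smul (hd (hd hρ))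
      ((hc.fderiv_apply (𝕜 := ℝ) (e3 j)).fderiv_apply (𝕜 := ℝ) (e3 j)) (hz hz1)
    obtain ⟨Q1, hQ1⟩ := exists_schwartz_eq_integral_planeWave P1
    obtain ⟨Q2, hQ2⟩ := exists_schwartz_eq_integral_planeWave P2
    obtain ⟨S1, hS1⟩ := exists_schwartz_eq_inner_mul Q1 (e3 j)
    refine ⟨Q2 - (2 : ℂ) • S1, fun b => ?_⟩
    simp [hS1, hQ1, hQ2, hP1, hP2]
  choose S hS using key
  refine ⟨(4 * Real.pi : ℂ)⁻¹ • ∑ j, S j, fun b => ?_⟩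
  have hπ : (Real.pi : ℂ) ≠ 0 := by simp [Real.pi_ne_zero]
  rw [norm_sq_mul_integral_planeWave (contDiff_infty.1 hρ 2) hc b, h1.eq_of_nhds]
  simp only [smul_apply, sum_apply, hS, smul_eq_mul, Pi.one_apply]
  field_simp

lemma hasFDerivAt_inv_norm {z : E3} (hz : z ≠ 0) :
    HasFDerivAt (fun z : E3 => ‖z‖⁻¹) (-(‖z‖⁻¹ ^ 3 • innerSL ℝ z)) z := by
  have hz' : ‖z‖ ≠ 0 := norm_ne_zero_iff.2 hz
  have h := ((hasStrictFDerivAt_norm_sq z).hasFDerivAt.sqrt (by positivity))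
  simp only [Real.sqrt_sq (norm_nonneg _)] at h
  refine ((hasDerivAt_inv hz').comp_hasFDerivAt z h).congr_fderiv ?_
  ext v
  simp
  field_simp

lemma toC3_BSker {χ : E3 → ℝ} (hχ : Differentiable ℝ χ) {ℓ : ℝ} (hℓ : 0 < ℓ) {x y : E3}
    (hxy : x ≠ y) (j : Fin 3) :
    toC3 (BSker χ ℓ x y) j
      = -(ℓ ^ 2 : ℝ) * newtonDeriv (fun z => (χ z : ℂ)) (e3 j) (ℓ • (x - y)) := by
  have hu : ℓ • (x - y) ≠ 0 := smul_ne_zero hℓ.ne' (sub_ne_zero.2 hxy)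
  have hq := (hχ (ℓ • (x - y))).hasFDerivAt.mul (hasFDerivAt_inv_norm hu)
  have hl : HasFDerivAt (fun z : E3 => ℓ • (x - z)) (ℓ • -(ContinuousLinearMap.id ℝ E3)) y :=
    ((hasFDerivAt_id y).const_sub x).const_smul ℓ
  have h : HasFDerivAt (fun z => ℓ * (χ (ℓ • (x - z)) * ‖ℓ • (x - z)‖⁻¹)) _ y :=
    (hq.comp y hl).const_mul ℓ
  have e : (fun z => χ (ℓ • (x - z)) / ‖x - z‖)
      = fun z => ℓ * (χ (ℓ • (x - z)) * ‖ℓ • (x - z)‖⁻¹) := by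
    ext z
    rw [norm_smul, Real.norm_of_nonneg hℓ.le, mul_inv, div_eq_mul_inv]
    field_simp
  have hj : BSker χ ℓ x y j = ⟪BSker χ ℓ x y, e3 j⟫ := by
    simp [e3, EuclideanSpace.inner_single_right]
  have hd : fderiv ℝ (fun z => (χ z : ℂ)) (ℓ • (x - y)) (e3 j)
      = (fderiv ℝ χ (ℓ • (x - y)) (e3 j) : ℝ) := by
    have := Complex.ofRealCLM.hasFDerivAt.comp (ℓ • (x - y)) (hχ (ℓ • (x - y))).hasFDerivAt
    exact congrArg (· (e3 j)) this.fderiv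
  rw [toC3, hj, BSker, inner_gradient_left, e, h.fderiv, newtonDeriv, hd]
  simp only [Complex.real_smul]
  norm_cast
  simp
  rw [real_inner_smul_left, inner_sub_left]
  ring

lemma exp_inner_mul_toC3_BSker {χ : E3 → ℝ} (hχ : Differentiable ℝ χ) {ℓ : ℝ} (hℓ : 0 < ℓ)
    (a x : E3) (j : Fin 3) :
    (fun y => Complex.exp (Complex.I * (⟪a, y⟫ : ℝ)) * toC3 (BSker χ ℓ x y) j)
      =ᵐ[volume] fun y => -(ℓ ^ 2 : ℝ) * Complex.exp (Complex.I * (⟪a, x⟫ : ℝ)) *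
        (newtonDeriv (fun z => (χ z : ℂ)) (e3 j) (ℓ • (x - y))
          * planeWave (ℓ⁻¹ • a) (ℓ • (x - y))) := by
  filter_upwards [(volume : Measure E3).ae_ne x] with y hy
  have h : planeWave (ℓ⁻¹ • a) (ℓ • (x - y)) = Complex.exp (Complex.I * (⟪a, y⟫ : ℝ))
      * Complex.exp (-(Complex.I * (⟪a, x⟫ : ℝ))) := by
    rw [planeWave, ← Complex.exp_add, real_inner_smul_left, real_inner_smul_right,
      inv_mul_cancel_left₀ hℓ.ne', inner_sub_right]
    push_cast
    ring_nf
  rw [toC3_BSker hχ hℓ hy.symm, h, Complex.exp_neg]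
  field_simp

lemma integrable_exp_inner_mul_toC3_BSker {χ : E3 → ℝ} (hχ : ContDiff ℝ 1 χ)
    (hc : HasCompactSupport χ) {ℓ : ℝ} (hℓ : 0 < ℓ) (a x : E3) (j : Fin 3) :
    Integrable fun y => Complex.exp (Complex.I * (⟪a, y⟫ : ℝ)) * toC3 (BSker χ ℓ x y) j := by
  rw [integrable_congr (exp_inner_mul_toC3_BSker (hχ.differentiable one_ne_zero) hℓ a x j)]
  have h := integrable_newtonDeriv_mul_planeWave (Complex.ofRealCLM.contDiff.comp hχ)
    (hc.comp_left Complex.ofReal_zero) (ℓ⁻¹ • a) (e3 j)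
  exact ((h.comp_smul hℓ.ne').comp_sub_left x).const_mul _

lemma integral_exp_inner_mul_toC3_BSker {χ : E3 → ℝ} (hχ : ContDiff ℝ 1 χ)
    (hc : HasCompactSupport χ) {ℓ : ℝ} (hℓ : 0 < ℓ) (a x : E3) (j : Fin 3) :
    ∫ y, Complex.exp (Complex.I * (⟪a, y⟫ : ℝ)) * toC3 (BSker χ ℓ x y) j
      = -(Complex.I * Complex.exp (Complex.I * (⟪a, x⟫ : ℝ)) * (ℓ ^ 2)⁻¹ * toC3 a j)
        * ∫ z : E3, (‖z‖⁻¹ • (χ z : ℂ)) * planeWave (ℓ⁻¹ • a) z := by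
  rw [integral_congr_ae (exp_inner_mul_toC3_BSker (hχ.differentiable one_ne_zero) hℓ a x j),
    integral_const_mul, integral_sub_left_eq_self (fun u : E3 =>
      newtonDeriv (fun z => (χ z : ℂ)) (e3 j) (ℓ • u) * planeWave (ℓ⁻¹ • a) (ℓ • u)),
    Measure.integral_comp_smul volume (fun u : E3 =>
      newtonDeriv (fun z => (χ z : ℂ)) (e3 j) u * planeWave (ℓ⁻¹ • a) u),
    integral_newtonDeriv_mul_planeWave (ρ := fun z => (χ z : ℂ)) (Complex.ofRealCLM.contDiff.comp hχ)
      (hc.comp_left Complex.ofReal_zero), abs_of_nonneg (by positivity)]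
  have hℓ' : (ℓ : ℂ) ≠ 0 := by exact_mod_cast hℓ.ne'
  simp [e3, EuclideanSpace.inner_single_right, toC3]
  field_simp

/-! ## Statement 19 -/
theorem stmt_19 (χ : E3 → ℝ) (hχ : IsCutoff χ) :
    ∃ R : SchwartzMap E3 ℂ,
      ∀ v₀ a : E3, v₀ ≠ 0 → a ≠ 0 → ∀ ℓ : ℝ, 0 < ℓ → ℓ ≤ 1 → ∀ x : E3,
        BSregC χ ℓ (fun y => Complex.exp (Complex.I * (⟪a, y⟫ : ℂ)) • toC3 v₀) x
          = (Complex.I * Complex.exp (Complex.I * (⟪a, x⟫ : ℂ)) * (1 + R (ℓ⁻¹ • a))) •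
              toC3 (cross3 ((‖a‖ ^ 2)⁻¹ • a) v₀) := by
  have hs : ContDiff ℝ 1 χ := hχ.1.of_le (by exact_mod_cast le_top)
  have hc : HasCompactSupport χ :=
    HasCompactSupport.intro (isCompact_closedBall 0 2) fun z hz => hχ.2.2 z <| by
      simpa using (not_le.1 fun h => hz (mem_closedBall_zero_iff.2 h)).le
  have h1 : (fun z => (χ z : ℂ)) =ᶠ[nhds 0] 1 := by
    filter_upwards [Metric.closedBall_mem_nhds (0 : E3) one_pos] with z hz
    simp [hχ.2.1 z (mem_closedBall_zero_iff.1 hz)]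
  obtain ⟨R, hR⟩ := exists_schwartz_norm_sq_mul_integral_planeWave
    (Complex.ofRealCLM.contDiff.comp hχ.1) (hc.comp_left Complex.ofReal_zero) h1
  refine ⟨R, fun v₀ a _ ha ℓ hℓ _ x => ?_⟩
  have hi := integrable_exp_inner_mul_toC3_BSker hs hc hℓ a x
  have hI : ∀ j, ∫ y, Complex.exp (Complex.I * (⟪a, y⟫ : ℝ)) * toC3 (BSker χ ℓ x y) j
      = -(4 * Real.pi * (Complex.I * Complex.exp (Complex.I * (⟪a, x⟫ : ℝ))
        * (1 + R (ℓ⁻¹ • a)) * (‖a‖ ^ 2 : ℝ)⁻¹ * toC3 a j)) := fun j => by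
    have hℓ' : (ℓ : ℂ) ≠ 0 := by exact_mod_cast hℓ.ne'
    have ha' : (‖a‖ : ℂ) ≠ 0 := by exact_mod_cast norm_ne_zero_iff.2 ha
    have hK := hR (ℓ⁻¹ • a)
    rw [norm_smul, Real.norm_of_nonneg (by positivity)] at hK
    rw [integral_exp_inner_mul_toC3_BSker hs hc hℓ a x j]
    have hK' : ∫ z : E3, (‖z‖⁻¹ • (χ z : ℂ)) * planeWave (ℓ⁻¹ • a) z
        = 4 * Real.pi * (1 + R (ℓ⁻¹ • a)) * (ℓ ^ 2 / ‖a‖ ^ 2) := by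
      rw [← hK]
      push_cast
      field_simp
      rfl
    rw [hK']
    push_cast
    field_simp
  have hcross : ∀ j k, Integrable fun y => toC3 v₀ j
      * (Complex.exp (Complex.I * (⟪a, y⟫ : ℝ)) * toC3 (BSker χ ℓ x y) k) :=
    fun j k => (hi k).const_mul _
  have hcomp : ∀ j k l m, Integrable (fun y => Complex.exp (Complex.I * (⟪a, y⟫ : ℝ)) * toC3 v₀ j
        * toC3 (BSker χ ℓ x y) k - Complex.exp (Complex.I * (⟪a, y⟫ : ℝ)) * toC3 v₀ l
        * toC3 (BSker χ ℓ x y) m)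
      ∧ ∫ y, (Complex.exp (Complex.I * (⟪a, y⟫ : ℝ)) * toC3 v₀ j
        * toC3 (BSker χ ℓ x y) k - Complex.exp (Complex.I * (⟪a, y⟫ : ℝ)) * toC3 v₀ l
        * toC3 (BSker χ ℓ x y) m)
        = 4 * Real.pi * (Complex.I * Complex.exp (Complex.I * (⟪a, x⟫ : ℝ))
        * (1 + R (ℓ⁻¹ • a)) * ((‖a‖ ^ 2 : ℝ)⁻¹
          * (toC3 a m * toC3 v₀ l - toC3 a k * toC3 v₀ j))) := fun j k l m => by
    have e : ∀ y j k, Complex.exp (Complex.I * (⟪a, y⟫ : ℝ)) * toC3 v₀ j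
        * toC3 (BSker χ ℓ x y) k
        = toC3 v₀ j * (Complex.exp (Complex.I * (⟪a, y⟫ : ℝ)) * toC3 (BSker χ ℓ x y) k) :=
      fun y j k => by ring
    simp_rw [e]
    refine ⟨(hcross j k).sub (hcross l m), ?_⟩
    rw [integral_sub (hcross j k) (hcross l m), integral_const_mul, integral_const_mul, hI, hI]
    ring
  have hπ : (Real.pi : ℂ) ≠ 0 := by simp [Real.pi_ne_zero]
  ext i
  rw [BSregC, Pi.smul_apply, MeasureTheory.eval_integral]
  · fin_cases i
    · refine (congrArg ((4 * Real.pi)⁻¹ • ·) (hcomp 1 2 2 1).2).trans ?_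
      simp [cross3, vec3, toC3]
      field_simp
    · refine (congrArg ((4 * Real.pi)⁻¹ • ·) (hcomp 2 0 0 2).2).trans ?_
      simp [cross3, vec3, toC3]
      field_simp
    · refine (congrArg ((4 * Real.pi)⁻¹ • ·) (hcomp 0 1 1 0).2).trans ?_
      simp [cross3, vec3, toC3]
      field_simp
  · intro i
    fin_cases i
    · exact (hcomp 1 2 2 1).1
    · exact (hcomp 2 0 0 2).1
    · exact (hcomp 0 1 1 0).1

end
end
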